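/- arXiv:math/0601544 — 2 statements merged into one kernel-verified Lean document; each statement's English description precedes it below -/
import Mathlib

section
/- Let α ∈ (1/3, 1), let x, y : [0,2] → ℝ be α-Hölder, let A be an α-Lévy area of order 0 associated with γ = (x, y), and let f : ℝ → ℝ be of class C². For ε ∈ (0,1] and n ∈ ℕ set I_n(ε) = 2^n ε^{−1} ∫_0^{ε⌊1/ε⌋} ((f(y(u)) + f(y(u + ε2^{−n})))/2)(x(u + ε2^{−n}) − x(u)) du + 2^n ε^{−1} ∫_0^{ε⌊1/ε⌋} f′(y(u)) A_{u, u+ε2^{−n}} du. Then the sequence of functions (I_n) converges uniformly on every compact subset of (0,1] to a limit function I_∞, and there exists C > 0 such that |I_∞(ε) − I_ε^{[0,1]}(f)| ≤ C ε^{min(3α−1, α)} for all ε ∈ (0,1]. -/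
open MeasureTheory Filter Set

/-- `z` is `α`-Hölder on the interval `[a, b]`. -/
def HolderOnIcc (α a b : ℝ) (z : ℝ → ℝ) : Prop :=
  ∃ L > 0, ∀ s ∈ Set.Icc a b, ∀ t ∈ Set.Icc a b, |z t - z s| ≤ L * |t - s| ^ α

/-- `A` is an `α`-Lévy area of order 0 associated with `γ = (x, y)` on `[0, 2]`. -/
def IsLevyArea0 (α : ℝ) (x y : ℝ → ℝ) (A : ℝ → ℝ → ℝ) : Prop :=
  (∀ r ∈ Set.Icc (0:ℝ) 2, ∀ s ∈ Set.Icc (0:ℝ) 2, ∀ t ∈ Set.Icc (0:ℝ) 2,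
    A r s + A s t + A t r
      = -(1/2) * ((y t - y s) * (x r - x s) - (y r - y s) * (x t - x s)))
  ∧ ∃ C > 0, ∀ s ∈ Set.Icc (0:ℝ) 2, ∀ t ∈ Set.Icc (0:ℝ) 2,
      |A s t| ≤ C * |t - s| ^ (2 * α)

/-- The `ε`-approximation `I_ε^{[a,b]}(f)` of the corrected symmetric integral. -/
noncomputable def Ieps (x y : ℝ → ℝ) (A : ℝ → ℝ → ℝ) (f : ℝ → ℝ) (a b ε : ℝ) : ℝ :=
  ε⁻¹ * (∫ u in a..b, ((f (y u) + f (y (u + ε))) / 2) * (x (u + ε) - x u))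
    + ε⁻¹ * (∫ u in a..b, deriv f (y u) * A u (u + ε))


/-- The dyadic refinement `I_n(ε)` of the approximation of the corrected symmetric
integral on `[0, 1]`. -/
noncomputable def Idyad (x y : ℝ → ℝ) (A : ℝ → ℝ → ℝ) (f : ℝ → ℝ) (n : ℕ) (ε : ℝ) : ℝ :=
  2 ^ n * ε⁻¹ * (∫ u in (0:ℝ)..(ε * (⌊1/ε⌋ : ℝ)),
      ((f (y u) + f (y (u + ε / 2 ^ n))) / 2) * (x (u + ε / 2 ^ n) - x u))
    + 2 ^ n * ε⁻¹ * (∫ u in (0:ℝ)..(ε * (⌊1/ε⌋ : ℝ)), deriv f (y u) * A u (u + ε / 2 ^ n))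

/-- Abstract dyadic comparison step. -/
lemma step_bound (G : ℝ → ℝ → ℝ) (C α : ℝ) (hC : 0 < C)
    (hb : ∀ u h, 0 ≤ u → 0 ≤ h → h ≤ 1 → u + h ≤ 2 → |G u (u + h)| ≤ C * h ^ α)
    (hs : ∀ u h, 0 ≤ u → 0 ≤ h → h ≤ 1 → u + h + h ≤ 2 →
      |G u (u + h + h) - G u (u + h) - G (u + h) (u + h + h)| ≤ C * h ^ (3 * α))
    (hc : ∀ h, 0 ≤ h → h ≤ 1 → ContinuousOn (fun u => G u (u + h)) (Icc 0 (2 - h)))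
    (h T : ℝ) (h0 : 0 < h) (h1 : 2 * h ≤ 1) (T0 : 0 ≤ T) (T1 : T ≤ 1) :
    |(2 * h)⁻¹ * (∫ u in (0:ℝ)..T, G u (u + 2 * h)) - h⁻¹ * (∫ u in (0:ℝ)..T, G u (u + h))|
      ≤ 2 * C * h ^ min (3 * α - 1) α := by
  have hint : ∀ k, 0 ≤ k → k ≤ 1 → ∀ a b, 0 ≤ a → a ≤ b → b + k ≤ 2 →
      IntervalIntegrable (fun u => G u (u + k)) volume a b := by
    intro k k0 k1 a b ha hab hbk
    apply ContinuousOn.intervalIntegrable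
    rw [uIcc_of_le hab]
    exact (hc k k0 k1).mono (Icc_subset_Icc ha (by linarith))
  have hbd : ∀ a, 0 ≤ a → a ≤ 1 → |∫ u in a..(a + h), G u (u + h)| ≤ C * h ^ α * h := by
    intro a ha ha1
    have := intervalIntegral.norm_integral_le_of_norm_le_const
      (a := a) (b := a + h) (C := C * h ^ α) (f := fun u => G u (u + h)) (by
        intro u hu
        rw [uIoc_of_le (by linarith)] at hu
        exact hb u h (by linarith [hu.1]) h0.le (by linarith) (by linarith [hu.2]))
    rw [add_sub_cancel_left, abs_of_pos h0] at this
    exact this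
  have hshift : (∫ u in (0:ℝ)..T, G (u + h) (u + h + h)) = ∫ u in h..(T + h), G u (u + h) := by
    have := intervalIntegral.integral_comp_add_right (a := 0) (b := T) (fun u => G u (u + h)) h
    simpa using this
  have hsh_int : IntervalIntegrable (fun u => G (u + h) (u + h + h)) volume 0 T := by
    apply ContinuousOn.intervalIntegrable
    rw [uIcc_of_le T0]
    refine (hc h h0.le (by linarith)).comp (f := fun u => u + h) (by fun_prop) ?_
    intro u hu
    exact ⟨by simp only; linarith [hu.1], by simp only; linarith [hu.2]⟩
  have i1 := hint h h0.le (by linarith) 0 h le_rfl h0.le (by linarith)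
  have i2 := hint h h0.le (by linarith) h (T + h) h0.le (by linarith) (by linarith)
  have i3 := hint h h0.le (by linarith) 0 T le_rfl T0 (by linarith)
  have i4 := hint h h0.le (by linarith) T (T + h) T0 (by linarith) (by linarith)
  have e1 := intervalIntegral.integral_add_adjacent_intervals i1 i2
  have e2 := intervalIntegral.integral_add_adjacent_intervals i3 i4
  have i5 : IntervalIntegrable (fun u => G u (u + h + h)) volume 0 T := by
    have := hint (2 * h) (by linarith) h1 0 T le_rfl T0 (by linarith)
    refine this.congr ?_
    intro u _
    simp only [two_mul, add_assoc]
  have e3 : (∫ u in (0:ℝ)..T, (G u (u + h + h) - G u (u + h) - G (u + h) (u + h + h)))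
      = (∫ u in (0:ℝ)..T, G u (u + h + h)) - (∫ u in (0:ℝ)..T, G u (u + h))
        - ∫ u in (0:ℝ)..T, G (u + h) (u + h + h) := by
    rw [intervalIntegral.integral_sub (i5.sub i3) hsh_int, intervalIntegral.integral_sub i5 i3]
  have e4 : |∫ u in (0:ℝ)..T, (G u (u + h + h) - G u (u + h) - G (u + h) (u + h + h))|
      ≤ C * h ^ (3 * α) := by
    have := intervalIntegral.norm_integral_le_of_norm_le_const
      (a := 0) (b := T) (C := C * h ^ (3 * α))
      (f := fun u => (G u (u + h + h) - G u (u + h) - G (u + h) (u + h + h))) (by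
        intro u hu
        rw [uIoc_of_le T0] at hu
        exact hs u h (by linarith [hu.1]) h0.le (by linarith) (by linarith [hu.2]))
    rw [sub_zero, abs_of_nonneg T0] at this
    refine this.trans ?_
    have : 0 ≤ C * h ^ (3 * α) := by positivity
    nlinarith
  have e5 : (∫ u in (0:ℝ)..T, G u (u + 2 * h)) = ∫ u in (0:ℝ)..T, G u (u + h + h) := by
    simp only [two_mul, add_assoc]
  have b1 := hbd 0 le_rfl (by norm_num)
  have b2 := hbd T T0 T1
  rw [zero_add] at b1
  have p1 : h ^ (3 * α) = h ^ (3 * α - 1) * h := by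
    rw [Real.rpow_sub_one h0.ne']; field_simp
  have p2 : h ^ (3 * α - 1) ≤ h ^ min (3 * α - 1) α :=
    Real.rpow_le_rpow_of_exponent_ge h0 (by linarith) (min_le_left _ _)
  have p3 : h ^ α ≤ h ^ min (3 * α - 1) α :=
    Real.rpow_le_rpow_of_exponent_ge h0 (by linarith) (min_le_right _ _)
  set P := h ^ min (3 * α - 1) α
  have key : (2 * h)⁻¹ * (∫ u in (0:ℝ)..T, G u (u + 2 * h)) - h⁻¹ * (∫ u in (0:ℝ)..T, G u (u + h))
      = (2 * h)⁻¹ * ((∫ u in (0:ℝ)..T, (G u (u + h + h) - G u (u + h) - G (u + h) (u + h + h)))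
        - (∫ u in (0:ℝ)..h, G u (u + h)) + ∫ u in T..(T + h), G u (u + h)) := by
    have e6 : (∫ u in T..(T + h), G u (u + h)) = (∫ u in (0:ℝ)..h, G u (u + h))
       + (∫ u in (0:ℝ)..T, G (u + h) (u + h + h)) - ∫ u in (0:ℝ)..T, G u (u + h) := by
      rw [hshift]; linarith
    rw [e3, e5, e6]
    field_simp
    ring
  rw [key, abs_mul, abs_of_pos (by positivity : 0 < (2 * h)⁻¹), inv_mul_le_iff₀ (by positivity)]
  have t1 : C * h ^ (3 * α) ≤ C * P * h := by
    rw [p1]; have := mul_le_mul_of_nonneg_left p2 (by positivity : 0 ≤ C * h); nlinarith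
  have t2 : C * h ^ α * h ≤ C * P * h := by
    have := mul_le_mul_of_nonneg_left p3 (by positivity : 0 ≤ C * h); nlinarith
  have t3 : 0 ≤ C * P * h := by positivity
  rw [abs_le] at *
  constructor <;> nlinarith

lemma abstract_conv (G : ℝ → ℝ → ℝ) (C α : ℝ) (hC : 0 < C) (hα : 1 / 3 < α)
    (hb : ∀ u h, 0 ≤ u → 0 ≤ h → h ≤ 1 → u + h ≤ 2 → |G u (u + h)| ≤ C * h ^ α)
    (hs : ∀ u h, 0 ≤ u → 0 ≤ h → h ≤ 1 → u + h + h ≤ 2 →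
      |G u (u + h + h) - G u (u + h) - G (u + h) (u + h + h)| ≤ C * h ^ (3 * α))
    (hc : ∀ h, 0 ≤ h → h ≤ 1 → ContinuousOn (fun u => G u (u + h)) (Icc 0 (2 - h)))
    (J : ℕ → ℝ → ℝ) (I : ℝ → ℝ)
    (hJ : ∀ n, ∀ ε ∈ Ioc (0:ℝ) 1, J n ε = (ε / 2 ^ n)⁻¹ *
      ∫ u in (0:ℝ)..(ε * (⌊1/ε⌋ : ℝ)), G u (u + ε / 2 ^ n))
    (hI : ∀ ε ∈ Ioc (0:ℝ) 1, I ε = ε⁻¹ * ∫ u in (0:ℝ)..1, G u (u + ε)) :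
    ∃ Iinf : ℝ → ℝ, TendstoUniformlyOn J Iinf atTop (Ioc 0 1) ∧
      ∃ C > 0, ∀ ε ∈ Ioc (0:ℝ) 1, |Iinf ε - I ε| ≤ C * ε ^ min (3 * α - 1) α := by
  set β := min (3 * α - 1) α with hβ
  have β0 : 0 < β := lt_min (by linarith) (by linarith)
  set r : ℝ := (1 / 2) ^ β with hr
  have r0 : 0 < r := by positivity
  have r1 : r < 1 := Real.rpow_lt_one (by norm_num) (by norm_num) β0
  have hT : ∀ ε ∈ Ioc (0:ℝ) 1, 0 ≤ ε * (⌊1/ε⌋ : ℝ) ∧ ε * (⌊1/ε⌋ : ℝ) ≤ 1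
      ∧ 1 - ε * (⌊1/ε⌋ : ℝ) ≤ ε := by
    intro ε hε
    have h0 := hε.1
    have hf : (0:ℝ) ≤ (⌊1/ε⌋ : ℝ) := by
      exact_mod_cast Int.floor_nonneg.2 (by positivity)
    have h1 := Int.floor_le (1 / ε)
    have h2 := (Int.lt_floor_add_one (1 / ε)).le
    rw [le_div_iff₀ h0] at h1
    rw [div_le_iff₀ h0] at h2
    refine ⟨by positivity, by linarith, by linarith⟩
  have hstep : ∀ ε ∈ Ioc (0:ℝ) 1, ∀ n, dist (J n ε) (J (n + 1) ε) ≤ (2 * C * ε ^ β) * r ^ n := by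
    intro ε hε n
    obtain ⟨T0, T1, T2⟩ := hT ε hε
    have h0 := hε.1
    have hle : ε / 2 ^ n ≤ 1 := by
      rw [div_le_one (by positivity)]
      exact hε.2.trans (one_le_pow₀ (by norm_num))
    have h2 : 2 * (ε / 2 ^ (n + 1)) = ε / 2 ^ n := by
      rw [pow_succ]; field_simp
    have := step_bound G C α hC hb hs hc (ε / 2 ^ (n + 1)) _ (by positivity) (by rw [h2]; exact hle) T0 T1
    rw [h2] at this
    rw [hJ n ε hε, hJ (n + 1) ε hε, Real.dist_eq]
    refine this.trans ?_
    rw [mul_assoc (2 * C)]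
    have : (ε / 2 ^ (n + 1)) ^ β ≤ ε ^ β * r ^ n := by
      have e : r ^ n = ((1 / 2) ^ n : ℝ) ^ β := by
        rw [hr, ← Real.rpow_natCast, ← Real.rpow_mul (by norm_num), mul_comm,
          Real.rpow_mul (by norm_num), Real.rpow_natCast]
      rw [e, ← Real.mul_rpow h0.le (by positivity)]
      apply Real.rpow_le_rpow (by positivity) _ β0.le
      rw [one_div, inv_pow, ← div_eq_mul_inv, pow_succ]
      apply div_le_div_of_nonneg_left h0.le (by positivity)
      have : (0:ℝ) < 2 ^ n := by positivity
      linarith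
    gcongr
  have hlim : ∀ ε ∈ Ioc (0:ℝ) 1, ∃ l, Tendsto (fun n => J n ε) atTop (nhds l) := by
    intro ε hε
    exact cauchySeq_tendsto_of_complete (cauchySeq_of_le_geometric r _ r1 (hstep ε hε))
  choose! Iinf hIinf using hlim
  refine ⟨Iinf, ?_, 2 * C / (1 - r) + C, ?_, ?_⟩
  · rw [Metric.tendstoUniformlyOn_iff]
    intro δ δ0
    have ht : Tendsto (fun n : ℕ => (2 * C) * r ^ n / (1 - r)) atTop (nhds 0) := by
      have := ((tendsto_pow_atTop_nhds_zero_of_lt_one r0.le r1).const_mul (2 * C)).div_const (1 - r)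
      simpa using this
    filter_upwards [ht.eventually_lt_const δ0] with n hn ε hε
    have := dist_le_of_le_geometric_of_tendsto r _ r1 (hstep ε hε) (hIinf ε hε) n
    rw [dist_comm]
    refine lt_of_le_of_lt (this.trans ?_) hn
    have h1 : ε ^ β ≤ 1 := Real.rpow_le_one hε.1.le hε.2 β0.le
    have h2 : 0 ≤ 1 - r := by linarith
    have h3 : 2 * C * ε ^ β ≤ 2 * C := by nlinarith
    gcongr
  · have : 0 < 1 - r := by linarith
    positivity
  · intro ε hε
    obtain ⟨T0, T1, T2⟩ := hT ε hε
    have h0 := hε.1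
    have d1 := dist_le_of_le_geometric_of_tendsto₀ r _ r1 (hstep ε hε) (hIinf ε hε)
    rw [dist_comm, Real.dist_eq] at d1
    have d2 : |J 0 ε - I ε| ≤ C * ε ^ β := by
      have hint : ∀ a b, 0 ≤ a → a ≤ b → b ≤ 1 →
          IntervalIntegrable (fun u => G u (u + ε)) volume a b := by
        intro a b ha hab hb1
        apply ContinuousOn.intervalIntegrable
        rw [uIcc_of_le hab]
        exact (hc ε h0.le hε.2).mono (Icc_subset_Icc ha (by linarith [hε.2]))
      have e := intervalIntegral.integral_add_adjacent_intervals
        (hint 0 _ le_rfl T0 T1) (hint _ 1 T0 T1 le_rfl)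
      have hbd := intervalIntegral.norm_integral_le_of_norm_le_const
        (a := ε * (⌊1/ε⌋ : ℝ)) (b := 1) (C := C * ε ^ α) (f := fun u => G u (u + ε)) (by
          intro u hu
          rw [uIoc_of_le T1] at hu
          exact hb u ε (by linarith [hu.1]) h0.le hε.2 (by linarith [hu.2, hε.2]))
      rw [abs_of_nonneg (by linarith), Real.norm_eq_abs] at hbd
      rw [hJ 0 ε hε, hI ε hε, ← e, pow_zero, div_one, ← mul_sub, sub_add_cancel_left, abs_mul,
        abs_neg, abs_of_pos (by positivity : 0 < ε⁻¹), inv_mul_le_iff₀ h0]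
      have p3 : ε ^ α ≤ ε ^ β :=
        Real.rpow_le_rpow_of_exponent_ge h0 hε.2 (min_le_right _ _)
      calc _ ≤ _ := hbd
        _ ≤ C * ε ^ β * ε := by gcongr
        _ = _ := by ring
    calc |Iinf ε - I ε| ≤ |Iinf ε - J 0 ε| + |J 0 ε - I ε| := abs_sub_le _ _ _
      _ ≤ 2 * C * ε ^ β / (1 - r) + C * ε ^ β := add_le_add d1 d2
      _ = _ := by ring

/-- Second-order facts on a bounded interval. -/
lemma taylor_facts (f : ℝ → ℝ) (hf : ContDiff ℝ 2 f) (R : ℝ) :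
    ∃ K > 0, (∀ a ∈ Icc (-R) R, |f a| ≤ K ∧ |deriv f a| ≤ K) ∧
      (∀ a ∈ Icc (-R) R, ∀ b ∈ Icc (-R) R, |deriv f b - deriv f a| ≤ K * |b - a|) ∧
      (∀ a ∈ Icc (-R) R, ∀ b ∈ Icc (-R) R, |f b - f a - deriv f a * (b - a)| ≤ K * |b - a| ^ 2) := by
  have hd1 : ContDiff ℝ 1 (deriv f) := by
    have : ContDiff ℝ (1 + 1) f := by norm_num; exact hf
    exact (contDiff_succ_iff_deriv.1 this).2.2
  have hfd : Differentiable ℝ f := hf.differentiable (by norm_num)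
  have hdd : Differentiable ℝ (deriv f) := hd1.differentiable (by norm_num)
  have c2 : Continuous (deriv (deriv f)) := hd1.continuous_deriv le_rfl
  obtain ⟨K0, h0⟩ := (isCompact_Icc (a := -R) (b := R)).exists_bound_of_continuousOn
    hf.continuous.continuousOn
  obtain ⟨K1, h1⟩ := (isCompact_Icc (a := -R) (b := R)).exists_bound_of_continuousOn
    hd1.continuous.continuousOn
  obtain ⟨K2, h2⟩ := (isCompact_Icc (a := -R) (b := R)).exists_bound_of_continuousOn
    c2.continuousOn
  set K := max 1 (max K0 (max K1 K2)) with hK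
  have k0 : K0 ≤ K := by simp [hK]
  have k1 : K1 ≤ K := by simp [hK]
  have k2 : K2 ≤ K := by simp [hK]
  have kp : 0 < K := lt_of_lt_of_le one_pos (le_max_left _ _)
  have lip : ∀ a ∈ Icc (-R) R, ∀ b ∈ Icc (-R) R, |deriv f b - deriv f a| ≤ K * |b - a| := by
    intro a ha b hb
    exact (convex_Icc (-R) R).norm_image_sub_le_of_norm_deriv_le (fun x _ => hdd x)
      (fun x hx => (h2 x hx).trans k2) ha hb
  refine ⟨K, kp, fun a ha => ⟨(h0 a ha).trans k0, (h1 a ha).trans k1⟩, lip, ?_⟩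
  intro a ha b hb
  have hsub : uIcc a b ⊆ Icc (-R) R := uIcc_subset_Icc ha hb
  have hder : ∀ t, HasDerivAt (fun t => f t - deriv f a * t) (deriv f t - deriv f a) t := by
    intro t
    have h1 := (hfd t).hasDerivAt.sub ((hasDerivAt_id t).const_mul (deriv f a))
    rw [mul_one] at h1
    exact h1
  have := (convex_uIcc a b).norm_image_sub_le_of_norm_hasDerivWithin_le
    (f := fun t => f t - deriv f a * t) (f' := fun t => deriv f t - deriv f a) (C := K * |b - a|)
    (fun t _ => (hder t).hasDerivWithinAt) (by
      intro t ht
      refine (lip a ha t (hsub ht)).trans ?_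
      have : |t - a| ≤ |b - a| := abs_sub_left_of_mem_uIcc ht
      gcongr) left_mem_uIcc right_mem_uIcc
  rw [Real.norm_eq_abs, Real.norm_eq_abs] at this
  calc _ = |f b - deriv f a * b - (f a - deriv f a * a)| := by congr 1; ring
    _ ≤ _ := this
    _ = _ := by ring

lemma holder_cont (α : ℝ) (hα : 0 < α) (z : ℝ → ℝ) (h : HolderOnIcc α 0 2 z) :
    ContinuousOn z (Icc 0 2) := by
  obtain ⟨L, L0, hL⟩ := h
  intro s hs
  rw [ContinuousWithinAt, tendsto_iff_dist_tendsto_zero]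
  have ht : Tendsto (fun t : ℝ => L * |t - s| ^ α) (nhdsWithin s (Icc 0 2)) (nhds 0) := by
    have : Continuous (fun t : ℝ => L * |t - s| ^ α) := by
      have : Continuous (fun t : ℝ => |t - s| ^ α) :=
        Continuous.rpow_const (by fun_prop) (fun _ => Or.inr hα.le)
      fun_prop
    have := (this.tendsto s).mono_left (nhdsWithin_le_nhds (s := Icc 0 2))
    simpa [Real.zero_rpow hα.ne'] using this
  refine squeeze_zero' (Eventually.of_forall fun _ => dist_nonneg) ?_ ht
  filter_upwards [self_mem_nhdsWithin] with t ht
  exact hL s hs t ht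

lemma area_cont (α : ℝ) (hα : 0 < α) (x y : ℝ → ℝ) (hx : ContinuousOn x (Icc 0 2))
    (hy : ContinuousOn y (Icc 0 2)) (A : ℝ → ℝ → ℝ) (hA : IsLevyArea0 α x y A)
    (h : ℝ) (h0 : 0 ≤ h) :
    ContinuousOn (fun u => A u (u + h)) (Icc 0 (2 - h)) := by
  obtain ⟨hrel, C, C0, hC⟩ := hA
  intro s hs
  have hs1 : s ∈ Icc (0:ℝ) 2 := ⟨hs.1, by linarith [hs.2]⟩
  have hs2 : s + h ∈ Icc (0:ℝ) 2 := ⟨by linarith [hs.1], by linarith [hs.2]⟩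
  have m1 : MapsTo (fun u : ℝ => u) (Icc 0 (2 - h)) (Icc 0 2) :=
    fun u hu => ⟨hu.1, by linarith [hu.2]⟩
  have m2 : MapsTo (fun u : ℝ => u + h) (Icc 0 (2 - h)) (Icc 0 2) :=
    fun u hu => ⟨by simp only; linarith [hu.1], by simp only; linarith [hu.2]⟩
  have cx1 : ContinuousWithinAt x (Icc 0 (2 - h)) s := (hx s hs1).mono m1
  have cy1 : ContinuousWithinAt y (Icc 0 (2 - h)) s := (hy s hs1).mono m1
  have cx2 : ContinuousWithinAt (fun u => x (u + h)) (Icc 0 (2 - h)) s :=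
    (hx.comp (f := fun u => u + h) (by fun_prop) m2) s hs
  have cy2 : ContinuousWithinAt (fun u => y (u + h)) (Icc 0 (2 - h)) s :=
    (hy.comp (f := fun u => u + h) (by fun_prop) m2) s hs
  have hz : ∀ s ∈ Icc (0:ℝ) 2, A s s = 0 := by
    intro s hs
    have := hC s hs s hs
    rw [sub_self, abs_zero, Real.zero_rpow (by positivity), mul_zero] at this
    exact abs_nonpos_iff.1 this
  have hsm : Tendsto (fun u : ℝ => C * |u - s| ^ (2 * α)) (nhdsWithin s (Icc 0 (2 - h))) (nhds 0) := by
    have : Continuous (fun t : ℝ => C * |t - s| ^ (2 * α)) := by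
      have : Continuous (fun t : ℝ => |t - s| ^ (2 * α)) :=
        Continuous.rpow_const (by fun_prop) (fun _ => Or.inr (by positivity))
      fun_prop
    have := (this.tendsto s).mono_left (nhdsWithin_le_nhds (s := Icc 0 (2 - h)))
    simpa [Real.zero_rpow (by positivity : 2 * α ≠ 0)] using this
  have a1 : ContinuousWithinAt (fun u => A s u) (Icc 0 (2 - h)) s := by
    rw [ContinuousWithinAt, hz s hs1]
    refine squeeze_zero_norm' ?_ hsm
    filter_upwards [self_mem_nhdsWithin] with u hu
    exact hC s hs1 u (m1 hu)
  have a2 : ContinuousWithinAt (fun u => A (s + h) (u + h)) (Icc 0 (2 - h)) s := by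
    rw [ContinuousWithinAt, hz _ hs2]
    refine squeeze_zero_norm' ?_ hsm
    filter_upwards [self_mem_nhdsWithin] with u hu
    have := hC (s + h) hs2 (u + h) (m2 hu)
    rwa [add_sub_add_right_eq_sub] at this
  have hanti : ∀ s ∈ Icc (0:ℝ) 2, ∀ t ∈ Icc (0:ℝ) 2, A t s = - A s t := by
    intro s hs t ht
    have := hrel s hs t ht s hs
    rw [hz s hs] at this
    linarith
  have key : ∀ u ∈ Icc 0 (2 - h), A u (u + h) =
      A s (s + h) + A (s + h) (u + h) - A s u
      + (1/2) * ((y (u + h) - y (s + h)) * (x s - x (s + h)) - (y s - y (s + h)) * (x (u + h) - x (s + h)))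
      - (1/2) * ((y (u + h) - y u) * (x s - x u) - (y s - y u) * (x (u + h) - x u)) := by
    intro u hu
    have r1 := hrel s hs1 (s + h) hs2 (u + h) (m2 hu)
    have r2 := hrel s hs1 u (m1 hu) (u + h) (m2 hu)
    linarith
  refine ContinuousWithinAt.congr ?_ key (key s hs)
  have k : ∀ c : ℝ, ContinuousWithinAt (fun _ : ℝ => c) (Icc 0 (2 - h)) s :=
    fun c => continuousWithinAt_const
  exact ((((k _).add a2).sub a1).add ((k _).mul
    (((cy2.sub (k _)).mul (k _)).sub ((k _).mul (cx2.sub (k _)))))).sub ((k _).mul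
    (((cy2.sub cy1).mul ((k _).sub cx1)).sub (((k _).sub cy1).mul (cx2.sub cx1))))

set_option maxHeartbeats 1000000

theorem stmt_3 (α : ℝ) (hα : α ∈ Set.Ioo (1/3 : ℝ) 1)
    (x y : ℝ → ℝ) (hx : HolderOnIcc α 0 2 x) (hy : HolderOnIcc α 0 2 y)
    (A : ℝ → ℝ → ℝ) (hA : IsLevyArea0 α x y A)
    (f : ℝ → ℝ) (hf : ContDiff ℝ 2 f) :
    ∃ Iinf : ℝ → ℝ,
      (∀ K : Set ℝ, K ⊆ Set.Ioc 0 1 → IsCompact K →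
        TendstoUniformlyOn (fun n ε => Idyad x y A f n ε) Iinf Filter.atTop K) ∧
      ∃ C > 0, ∀ ε ∈ Set.Ioc (0:ℝ) 1,
        |Iinf ε - Ieps x y A f 0 1 ε| ≤ C * ε ^ min (3 * α - 1) α := by
  have hα0 : 0 < α := by linarith [hα.1]
  have cx := holder_cont α hα0 x hx
  have cy := holder_cont α hα0 y hy
  have cA := area_cont α hα0 x y cx cy A hA
  obtain ⟨R, hR⟩ := (isCompact_Icc (a := (0:ℝ)) (b := 2)).exists_bound_of_continuousOn cy
  have hyR : ∀ u ∈ Icc (0:ℝ) 2, y u ∈ Icc (-R) R := fun u hu => abs_le.1 (hR u hu)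
  obtain ⟨K, K0, hK, hlip, htay⟩ := taylor_facts f hf R
  obtain ⟨Lx, Lx0, hLx⟩ := hx
  obtain ⟨Ly, Ly0, hLy⟩ := hy
  obtain ⟨hrel, CA, CA0, hCA⟩ := hA
  have hz : ∀ s ∈ Icc (0:ℝ) 2, A s s = 0 := by
    intro s hs
    have := hCA s hs s hs
    rw [sub_self, abs_zero, Real.zero_rpow (by positivity), mul_zero] at this
    exact abs_nonpos_iff.1 this
  have hanti : ∀ s ∈ Icc (0:ℝ) 2, ∀ t ∈ Icc (0:ℝ) 2, A t s = - A s t := by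
    intro s hs t ht
    have := hrel s hs t ht s hs
    rw [hz s hs] at this
    linarith
  have fc : Continuous f := hf.continuous
  have dfc : Continuous (deriv f) := hf.continuous_deriv (by norm_num)
  have c1 : ∀ h, 0 ≤ h → ContinuousOn
      (fun u => ((f (y u) + f (y (u + h))) / 2) * (x (u + h) - x u)) (Icc 0 (2 - h)) := by
    intro h h0
    have m1 : Icc 0 (2 - h) ⊆ Icc 0 2 := fun u hu => ⟨hu.1, by linarith [hu.2]⟩
    have m2 : MapsTo (fun u : ℝ => u + h) (Icc 0 (2 - h)) (Icc 0 2) :=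
      fun u hu => ⟨by simp only; linarith [hu.1], by simp only; linarith [hu.2]⟩
    have cx1 := cx.mono m1
    have cy1 := cy.mono m1
    have cx2 : ContinuousOn (fun u => x (u + h)) (Icc 0 (2 - h)) :=
      cx.comp (f := fun u => u + h) (by fun_prop) m2
    have cy2 : ContinuousOn (fun u => y (u + h)) (Icc 0 (2 - h)) :=
      cy.comp (f := fun u => u + h) (by fun_prop) m2
    have g1 := fc.comp_continuousOn cy1
    have g2 := fc.comp_continuousOn cy2
    exact ((g1.add g2).div_const 2).mul (cx2.sub cx1)
  have c2 : ∀ h, 0 ≤ h → ContinuousOn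
      (fun u => deriv f (y u) * A u (u + h)) (Icc 0 (2 - h)) := by
    intro h h0
    have m1 : Icc 0 (2 - h) ⊆ Icc 0 2 := fun u hu => ⟨hu.1, by linarith [hu.2]⟩
    exact (dfc.comp_continuousOn (cy.mono m1)).mul (cA h h0)
  have hsplit : ∀ h b, 0 ≤ h → 0 ≤ b → b + h ≤ 2 →
      (∫ u in (0:ℝ)..b, (((f (y u) + f (y (u + h))) / 2) * (x (u + h) - x u)
        + deriv f (y u) * A u (u + h)))
      = (∫ u in (0:ℝ)..b, ((f (y u) + f (y (u + h))) / 2) * (x (u + h) - x u))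
        + ∫ u in (0:ℝ)..b, deriv f (y u) * A u (u + h) := by
    intro h b h0 b0 hb
    have sub : uIcc 0 b ⊆ Icc 0 (2 - h) := by
      rw [uIcc_of_le b0]; exact Icc_subset_Icc le_rfl (by linarith)
    exact intervalIntegral.integral_add ((c1 h h0).mono sub).intervalIntegrable
      ((c2 h h0).mono sub).intervalIntegrable
  have hxh : ∀ u h, 0 ≤ u → 0 ≤ h → u + h ≤ 2 → |x (u + h) - x u| ≤ Lx * h ^ α := by
    intro u h u0 h0 hu
    have := hLx u ⟨u0, by linarith⟩ (u + h) ⟨by linarith, hu⟩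
    rwa [add_sub_cancel_left, abs_of_nonneg h0] at this
  have hyh : ∀ u h, 0 ≤ u → 0 ≤ h → u + h ≤ 2 → |y (u + h) - y u| ≤ Ly * h ^ α := by
    intro u h u0 h0 hu
    have := hLy u ⟨u0, by linarith⟩ (u + h) ⟨by linarith, hu⟩
    rwa [add_sub_cancel_left, abs_of_nonneg h0] at this
  have hAh : ∀ u h, 0 ≤ u → 0 ≤ h → u + h ≤ 2 → |A u (u + h)| ≤ CA * (h ^ α) ^ 2 := by
    intro u h u0 h0 hu
    have := hCA u ⟨u0, by linarith⟩ (u + h) ⟨by linarith, hu⟩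
    rw [add_sub_cancel_left, abs_of_nonneg h0, mul_comm 2 α, Real.rpow_mul h0] at this
    exact_mod_cast this
  obtain ⟨G, hG⟩ : ∃ G : ℝ → ℝ → ℝ, ∀ u v, G u v =
      ((f (y u) + f (y v)) / 2) * (x v - x u) + deriv f (y u) * A u v := ⟨_, fun _ _ => rfl⟩
  set C1 := K * Lx + K * CA with hC1
  set C2 := K * Ly ^ 2 * Lx * (3 / 2) + K * Ly * CA with hC2
  have C10 : 0 < C1 := by positivity
  have C20 : 0 < C2 := by positivity
  have hb : ∀ u h, 0 ≤ u → 0 ≤ h → h ≤ 1 → u + h ≤ 2 → |G u (u + h)| ≤ (C1 + C2) * h ^ α := by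
    intro u h u0 h0 h1 hu
    have p0 : 0 ≤ h ^ α := by positivity
    have p1 : h ^ α ≤ 1 := Real.rpow_le_one h0 h1 hα0.le
    have f1 := hK (y u) (hyR u ⟨u0, by linarith⟩)
    have f2 := hK (y (u + h)) (hyR (u + h) ⟨by linarith, hu⟩)
    have a1 := hxh u h u0 h0 hu
    have a2 := hAh u h u0 h0 hu
    have b1 : |(f (y u) + f (y (u + h))) / 2| ≤ K := by
      have := abs_le.1 f1.1
      have := abs_le.1 f2.1
      rw [abs_le]; constructor <;> linarith
    calc |G u (u + h)| ≤ |(f (y u) + f (y (u + h))) / 2| * |x (u + h) - x u|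
          + |deriv f (y u)| * |A u (u + h)| := by
            rw [← abs_mul, ← abs_mul, hG]; exact abs_add_le _ _
      _ ≤ K * (Lx * h ^ α) + K * (CA * (h ^ α) ^ 2) := by
            have := f1.2
            gcongr
      _ ≤ K * (Lx * h ^ α) + K * (CA * (h ^ α)) := by
            gcongr
            nlinarith
      _ = C1 * h ^ α := by rw [hC1]; ring
      _ ≤ _ := by nlinarith
  have hs : ∀ u h, 0 ≤ u → 0 ≤ h → h ≤ 1 → u + h + h ≤ 2 →
      |G u (u + h + h) - G u (u + h) - G (u + h) (u + h + h)| ≤ (C1 + C2) * h ^ (3 * α) := by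
    intro u h u0 h0 h1 hu
    have q : h ^ (3 * α) = (h ^ α) ^ 3 := by
      rw [mul_comm 3 α, Real.rpow_mul h0]; norm_cast
    rw [q]
    have p0 : 0 ≤ h ^ α := by positivity
    have x1 := hxh u h u0 h0 (by linarith)
    have x2 := hxh (u + h) h (by linarith) h0 hu
    have y1 := hyh u h u0 h0 (by linarith)
    have y2 := hyh (u + h) h (by linarith) h0 hu
    have a2 := hAh (u + h) h (by linarith) h0 hu
    have mu : u ∈ Icc (0:ℝ) 2 := ⟨u0, by linarith⟩
    have mv : u + h ∈ Icc (0:ℝ) 2 := ⟨by linarith, by linarith⟩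
    have mw : u + h + h ∈ Icc (0:ℝ) 2 := ⟨by linarith, by linarith⟩
    have rel := hrel u mu (u + h) mv (u + h + h) mw
    rw [hanti u mu _ mw] at rel
    have l1 := hlip _ (hyR _ mu) _ (hyR _ mv)
    have t1 := htay _ (hyR _ mu) _ (hyR _ mv)
    have t2 := htay _ (hyR _ mv) _ (hyR _ mw)
    simp only [hG]
    generalize u + h + h = w at *
    generalize u + h = v at *
    generalize h ^ α = p at *
    have ident : ((f (y u) + f (y w)) / 2) * (x w - x u) + deriv f (y u) * A u w
        - (((f (y u) + f (y v)) / 2) * (x v - x u) + deriv f (y u) * A u v)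
        - (((f (y v) + f (y w)) / 2) * (x w - x v) + deriv f (y v) * A v w)
        = (1 / 2) * (f (y w) - f (y v) - deriv f (y v) * (y w - y v)) * (x v - x u)
          + (1 / 2) * ((deriv f (y v) - deriv f (y u)) * (y w - y v)) * (x v - x u)
          - (1 / 2) * (f (y v) - f (y u) - deriv f (y u) * (y v - y u)) * (x w - x v)
          - (deriv f (y v) - deriv f (y u)) * A v w := by
      have : A u w = A u v + A v w
        + (1/2) * ((y w - y v) * (x u - x v) - (y u - y v) * (x w - x v)) := by linarith
      rw [this]; ring
    rw [ident]
    have l1' : |deriv f (y v) - deriv f (y u)| ≤ K * (Ly * p) := l1.trans (by gcongr)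
    have t1' : |f (y v) - f (y u) - deriv f (y u) * (y v - y u)| ≤ K * (Ly * p) ^ 2 :=
      t1.trans (by gcongr)
    have t2' : |f (y w) - f (y v) - deriv f (y v) * (y w - y v)| ≤ K * (Ly * p) ^ 2 :=
      t2.trans (by gcongr)
    have n1 := mul_le_mul t2' x1 (abs_nonneg _) (by positivity)
    have n2 := mul_le_mul (mul_le_mul l1' y2 (abs_nonneg _) (by positivity)) x1
      (abs_nonneg _) (by positivity)
    have n3 := mul_le_mul t1' x2 (abs_nonneg _) (by positivity)
    have n4 := mul_le_mul l1' a2 (abs_nonneg _) (by positivity)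
    simp only [← abs_mul] at n1 n2 n3 n4
    have fin : C2 * p ^ 3 ≤ (C1 + C2) * p ^ 3 := by
      have : 0 ≤ p ^ 3 := by positivity
      nlinarith
    refine le_trans ?_ fin
    rw [hC2]
    rw [abs_le] at n1 n2 n3 n4 ⊢
    constructor <;> linarith
  obtain ⟨Iinf, hu, C, hC, hbd⟩ := abstract_conv G (C1 + C2) α (by positivity) hα.1 hb hs
    (fun h h0 _ => by simp only [hG]; exact (c1 h h0).add (c2 h h0)) (fun n ε => Idyad x y A f n ε)
    (fun ε => Ieps x y A f 0 1 ε) (by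
      intro n ε hε
      have h0 := hε.1
      have hle : ε / 2 ^ n ≤ 1 := by
        rw [div_le_one (by positivity)]
        exact hε.2.trans (one_le_pow₀ (by norm_num))
      have hf : (0:ℝ) ≤ (⌊1/ε⌋ : ℝ) := by
        exact_mod_cast Int.floor_nonneg.2 (by positivity)
      have h1 := Int.floor_le (1 / ε)
      rw [le_div_iff₀ h0] at h1
      simp only [Idyad, hG]
      rw [hsplit _ _ (by positivity) (by positivity) (by linarith), inv_div, mul_add,
        div_eq_mul_inv (2 ^ n) ε]) (by
      intro ε hε
      simp only [Ieps, hG]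
      rw [hsplit _ _ hε.1.le (by norm_num) (by linarith [hε.2]), mul_add])
  exact ⟨Iinf, fun K hK _ => hu.mono hK, C, hC, hbd⟩
end

section
/- Let α ∈ (1/3, 1), let x : [0,3] → ℝ be α-Hölder, let h : ℝ² → ℝ be of class C², let ℓ : [0,3] → ℝ be Lipschitz, and define y(t) = h(x(t), ℓ(t)). Let A be defined by A_{rs} = ∫_r^s y(u) d°x(u) − ((y(r) + y(s))/2)(x(s) − x(r)) for r, s ∈ [0,2] (the Russo–Vallois symmetric integrals exist, and A is an α-Lévy area of order 0 associated with (x, y)). Then for every f : ℝ → ℝ of class C² and all 0 ≤ a ≤ b ≤ 1, the corrected symmetric integral ∫_a^b f(y(s)) d^{A,1}x(s) and the Russo–Vallois symmetric integral ∫_a^b f(y(s)) d°x(s) both exist and are equal. -/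
open MeasureTheory Filter Set

/-- `I` is the Russo–Vallois symmetric integral `∫_a^b z(s) d°x(s)` (for `a > b` the
interval integral is by convention the negative of the one from `b` to `a`). -/
def RVTendsto (z x : ℝ → ℝ) (a b I : ℝ) : Prop :=
  Filter.Tendsto
    (fun ε : ℝ => ε⁻¹ * ∫ s in a..b, ((z (s + ε) + z s) / 2) * (x (s + ε) - x s))
    (nhdsWithin 0 (Set.Ioi 0)) (nhds I)

open scoped Topology

noncomputable def GG (g : ℝ × ℝ → ℝ) (X l : ℝ) : ℝ := ∫ ξ in (0:ℝ)..X, g (ξ, l)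

lemma GG_sub (g : ℝ × ℝ → ℝ) (hg : Continuous g) (p q l : ℝ) :
    GG g q l - GG g p l = ∫ ξ in p..q, g (ξ, l) := by
  unfold GG
  rw [intervalIntegral.integral_interval_sub_left] <;>
  · apply Continuous.intervalIntegrable
    fun_prop

lemma GG_cont (g : ℝ × ℝ → ℝ) (hg : Continuous g) (u v : ℝ → ℝ) (hu : Continuous u)
    (hv : Continuous v) : Continuous (fun s => GG g (u s) (v s)) := by
  unfold GG
  apply intervalIntegral.continuous_parametric_intervalIntegral_of_continuous _ hu
  unfold Function.uncurry
  fun_prop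

lemma bounds (g : ℝ × ℝ → ℝ) (hg : ContDiff ℝ 2 g) (M : ℝ) :
    ∃ B : ℝ, 0 ≤ B ∧ ∀ p q l l' : ℝ, |p| ≤ M → |q| ≤ M → |l| ≤ M → |l'| ≤ M →
      |g (p, l') - g (p, l)| ≤ B * |l' - l| ∧
      |fderiv ℝ g (p, l) (1, 0) - fderiv ℝ g (q, l) (1, 0)| ≤ B * |p - q| := by
  have hK : IsCompact (Set.Icc (-M) M ×ˢ Set.Icc (-M) M) := isCompact_Icc.prod isCompact_Icc
  have hC : Convex ℝ (Set.Icc (-M) M ×ˢ Set.Icc (-M) M) := (convex_Icc _ _).prod (convex_Icc _ _)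
  obtain ⟨K1, h1⟩ := hg.contDiffOn.exists_lipschitzOnWith (by norm_num) hC hK
  have hD : ContDiff ℝ 1 (fun z => fderiv ℝ g z (1, 0)) :=
    (hg.fderiv_right (m := 1) (by norm_num)).clm_apply contDiff_const
  obtain ⟨K2, h2⟩ := hD.contDiffOn.exists_lipschitzOnWith (by norm_num) hC hK
  refine ⟨max K1 K2, le_trans K1.2 (le_max_left _ _), ?_⟩
  intro p q l l' hp hq hl hl'
  rw [abs_le] at hp hq hl hl'
  constructor
  · have := h1.dist_le_mul (p, l') ⟨hp, hl'⟩ (p, l) ⟨hp, hl⟩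
    rw [Real.dist_eq, Prod.dist_eq] at this
    simp only [dist_self, Real.dist_eq] at this
    rw [max_eq_right (abs_nonneg _)] at this
    exact this.trans (mul_le_mul_of_nonneg_right (le_max_left _ _) (abs_nonneg _))
  · have := h2.dist_le_mul (p, l) ⟨hp, hl⟩ (q, l) ⟨hq, hl⟩
    rw [Real.dist_eq, Prod.dist_eq] at this
    simp only [dist_self, Real.dist_eq] at this
    rw [max_eq_left (abs_nonneg _)] at this
    exact this.trans (mul_le_mul_of_nonneg_right (le_max_right _ _) (abs_nonneg _))

lemma trapezoid (φ φ' : ℝ → ℝ) (hφ : ∀ t, HasDerivAt φ (φ' t) t) (B p q : ℝ) (hB : 0 ≤ B)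
    (hL : ∀ t ∈ Set.uIcc p q, |φ' t - φ' p| ≤ B * |t - p|) :
    |(∫ ξ in p..q, φ ξ) - (φ q + φ p) / 2 * (q - p)| ≤ 2 * B * |q - p| ^ 3 := by
  have hc : Continuous φ := continuous_iff_continuousAt.2 fun t => (hφ t).continuousAt
  set R : ℝ → ℝ := fun t => φ t - φ p - φ' p * (t - p) with hR
  have hRc : Continuous R := by fun_prop
  have hRd : ∀ t, HasDerivAt R (φ' t - φ' p) t := by
    intro t
    have := ((hφ t).sub_const (φ p)).sub (((hasDerivAt_id t).sub_const p).const_mul (φ' p))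
    rw [mul_one] at this
    exact this
  have hmem : ∀ t ∈ Set.uIcc p q, |t - p| ≤ |q - p| := fun t ht => Set.abs_sub_left_of_mem_uIcc ht
  have hRb : ∀ t ∈ Set.uIcc p q, |R t| ≤ B * |q - p| ^ 2 := by
    intro t ht
    have := Convex.norm_image_sub_le_of_norm_hasDerivWithin_le (f := R)
      (f' := fun t => φ' t - φ' p) (C := B * |q - p|) (s := Set.uIcc p q)
      (fun t _ => (hRd t).hasDerivWithinAt)
      (fun t ht => (hL t ht).trans (mul_le_mul_of_nonneg_left (hmem t ht) hB))
      (convex_uIcc _ _) (Set.left_mem_uIcc) ht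
    have h0 : R p = 0 := by simp [hR]
    rw [h0, sub_zero, Real.norm_eq_abs, Real.norm_eq_abs] at this
    calc _ ≤ _ := this
      _ ≤ B * |q - p| * |q - p| := by
        apply mul_le_mul_of_nonneg_left (hmem t ht); positivity
      _ = _ := by ring
  have hI : (∫ ξ in p..q, φ ξ) = (∫ ξ in p..q, R ξ) + φ p * (q - p) + φ' p * ((q - p)^2/2) := by
    have : ∀ ξ, φ ξ = R ξ + (φ p + φ' p * (ξ - p)) := by intro ξ; simp [hR]
    rw [intervalIntegral.integral_congr (g := fun ξ => R ξ + (φ p + φ' p * (ξ - p)))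
      (fun ξ _ => this ξ)]
    rw [intervalIntegral.integral_add, intervalIntegral.integral_add]
    · simp
      ring
    all_goals
      apply Continuous.intervalIntegrable
      fun_prop
  have hIb : |∫ ξ in p..q, R ξ| ≤ B * |q - p| ^ 2 * |q - p| := by
    rw [← Real.norm_eq_abs (∫ ξ in p..q, R ξ)]
    apply intervalIntegral.norm_integral_le_of_norm_le_const
    intro t ht
    exact hRb t (Set.uIoc_subset_uIcc ht)
  have hq : φ q = R q + (φ p + φ' p * (q - p)) := by simp [hR]
  have : (∫ ξ in p..q, φ ξ) - (φ q + φ p) / 2 * (q - p)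
      = (∫ ξ in p..q, R ξ) - R q / 2 * (q - p) := by
    rw [hI, hq]; ring
  rw [this]
  calc _ ≤ |∫ ξ in p..q, R ξ| + |R q / 2 * (q - p)| := abs_sub _ _
    _ ≤ B * |q - p| ^ 2 * |q - p| + B * |q - p| ^ 2 / 2 * |q - p| := by
      rw [abs_mul, abs_div, abs_two]
      have := hRb q Set.right_mem_uIcc
      gcongr
    _ ≤ _ := by
      have : 0 ≤ B * |q - p| ^ 3 := by positivity
      nlinarith

lemma avg (H : ℝ → ℝ) (hH : Continuous H) (u v : ℝ) :
    Tendsto (fun δ : ℝ => δ⁻¹ * ∫ s in u..v, (H (s + δ) - H s)) (𝓝[>] 0) (𝓝 (H v - H u)) := by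
  have key : ∀ w, Tendsto (fun δ : ℝ => δ⁻¹ * ∫ s in w..(w + δ), H s) (𝓝[>] 0) (𝓝 (H w)) := by
    intro w
    have := intervalIntegral.integral_hasDerivAt_right (f := H) (a := w) (b := w)
      (hH.intervalIntegrable _ _) (hH.stronglyMeasurableAtFilter _ _) hH.continuousAt
    have := this.tendsto_slope_zero_right
    simpa using this
  refine ((key v).sub (key u)).congr fun δ => ?_
  have hi : ∀ a b, IntervalIntegrable H volume a b := fun a b => hH.intervalIntegrable _ _
  rw [← mul_sub, intervalIntegral.integral_sub _ (hi _ _),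
    intervalIntegral.integral_comp_add_right (f := H)]
  · congr 1
    have h1 := intervalIntegral.integral_add_adjacent_intervals (hi u v) (hi v (v+δ))
    have h2 := intervalIntegral.integral_add_adjacent_intervals (hi u (u+δ)) (hi (u+δ) (v+δ))
    linarith
  · apply Continuous.intervalIntegrable
    fun_prop

lemma GG_diff (g : ℝ × ℝ → ℝ) (hg : ContDiff ℝ 2 g) (X l : ℝ) :
    DifferentiableAt ℝ (fun l => GG g X l) l := by
  have hgc : Continuous g := hg.continuous
  have hD : Continuous (fun z => fderiv ℝ g z (0, 1)) :=
    ((hg.fderiv_right (m := 1) (by norm_num)).clm_apply contDiff_const).continuous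
  obtain ⟨C, hC⟩ := (isCompact_uIcc (a := (0:ℝ)) (b := X)).prod (isCompact_closedBall l 1)
    |>.exists_bound_of_continuousOn hD.continuousOn
  have := (intervalIntegral.hasDerivAt_integral_of_dominated_loc_of_deriv_le (μ := volume)
    (a := 0) (b := X)
    (F := fun l ξ => g (ξ, l)) (F' := fun l ξ => fderiv ℝ g (ξ, l) (0, 1)) (x₀ := l)
    (s := Metric.closedBall l 1) (bound := fun _ => C) (Metric.closedBall_mem_nhds l one_pos)
    (Eventually.of_forall fun l => (by fun_prop : Continuous fun ξ => g (ξ, l)).aestronglyMeasurable)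
    (Continuous.intervalIntegrable (by fun_prop) _ _)
    (hD.comp (by fun_prop : Continuous fun ξ : ℝ => (ξ, l))).aestronglyMeasurable
    (Eventually.of_forall fun ξ hξ l' hl' => hC (ξ, l') ⟨Set.uIoc_subset_uIcc hξ, hl'⟩)
    intervalIntegrable_const
    (Eventually.of_forall fun ξ hξ l' hl' => ?_)).2.differentiableAt
  · exact this
  · have h1 : HasFDerivAt g (fderiv ℝ g (ξ, l')) (ξ, l') :=
      (hg.differentiable (by norm_num) _).hasFDerivAt
    exact h1.comp_hasDerivAt l' ((hasDerivAt_const l' ξ).prodMk (hasDerivAt_id l'))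

noncomputable def Trap (g : ℝ × ℝ → ℝ) (x ℓ : ℝ → ℝ) (s t : ℝ) : ℝ :=
  ((g (x t, ℓ t) + g (x s, ℓ s)) / 2) * (x t - x s)

noncomputable def rho (α d : ℝ) : ℝ := d ^ (3 * α) + d ^ (1 + α)

lemma rho_nonneg (α d : ℝ) (hd : 0 ≤ d) : 0 ≤ rho α d := by
  unfold rho; positivity

lemma rho_lim (α : ℝ) (hα : 1/3 < α) :
    Tendsto (fun δ : ℝ => δ⁻¹ * rho α δ) (𝓝[>] 0) (𝓝 0) := by
  have h1 : ∀ β : ℝ, 0 < β → Tendsto (fun δ : ℝ => δ ^ β) (𝓝[>] 0) (𝓝 0) := by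
    intro β hβ
    have := (Real.continuousAt_rpow_const 0 β (Or.inr hβ.le)).tendsto
    rw [Real.zero_rpow hβ.ne'] at this
    exact this.mono_left nhdsWithin_le_nhds
  have h := (h1 (3 * α - 1) (by linarith)).add (h1 α (by linarith))
  rw [add_zero] at h
  refine h.congr' ?_
  filter_upwards [self_mem_nhdsWithin] with δ (hδ : 0 < δ)
  unfold rho
  rw [Real.rpow_sub hδ, Real.rpow_add hδ, Real.rpow_one]
  field_simp

/-- Global standing assumptions on the driving path and the Lipschitz path. -/
structure Setup (α M L K : ℝ) (x ℓ : ℝ → ℝ) : Prop where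
  hα : 1/3 < α
  hL : 0 ≤ L
  hK : 0 ≤ K
  hx : ∀ s t, |x t - x s| ≤ L * |t - s| ^ α
  hl : ∀ s t, |ℓ t - ℓ s| ≤ K * |t - s|
  bx : ∀ s, |x s| ≤ M
  bl : ∀ s, |ℓ s| ≤ M

lemma Setup.lip {α M L K : ℝ} {x ℓ : ℝ → ℝ} (S : Setup α M L K x ℓ) :
    LipschitzWith K.toNNReal ℓ := by
  apply LipschitzWith.of_dist_le_mul
  intro s t
  rw [Real.dist_eq, Real.dist_eq, Real.coe_toNNReal _ S.hK]
  exact S.hl t s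

lemma Setup.contx {α M L K : ℝ} {x ℓ : ℝ → ℝ} (S : Setup α M L K x ℓ) : Continuous x := by
  have hα : 0 < α := by have := S.hα; linarith
  rw [continuous_iff_continuousAt]
  intro s
  rw [ContinuousAt, tendsto_iff_dist_tendsto_zero]
  have h1 : Tendsto (fun t => L * |t - s| ^ α) (𝓝 s) (𝓝 0) := by
    have : Continuous (fun t => L * |t - s| ^ α) := by
      apply Continuous.mul continuous_const
      exact (by fun_prop : Continuous fun t => |t - s|).rpow_const (fun _ => Or.inr hα.le)
    have h := this.tendsto s
    simpa [Real.zero_rpow hα.ne'] using h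
  exact squeeze_zero (fun _ => dist_nonneg) (fun t => S.hx s t) h1

lemma mixed (g : ℝ × ℝ → ℝ) (hg : Continuous g) (M B : ℝ)
    (hB : ∀ p l l' : ℝ, |p| ≤ M → |l| ≤ M → |l'| ≤ M → |g (p, l') - g (p, l)| ≤ B * |l' - l|)
    (p q l l' : ℝ) (hp : |p| ≤ M) (hq : |q| ≤ M) (hl : |l| ≤ M) (hl' : |l'| ≤ M) :
    |(GG g p l' - GG g p l) - (GG g q l' - GG g q l)| ≤ B * |l' - l| * |p - q| := by
  have : (GG g p l' - GG g p l) - (GG g q l' - GG g q l)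
      = ∫ ξ in q..p, (g (ξ, l') - g (ξ, l)) := by
    rw [intervalIntegral.integral_sub, ← GG_sub g hg, ← GG_sub g hg]
    · ring
    all_goals
      apply Continuous.intervalIntegrable
      fun_prop
  rw [this, ← Real.norm_eq_abs (∫ ξ in q..p, _)]
  apply intervalIntegral.norm_integral_le_of_norm_le_const
  intro ξ hξ
  refine hB ξ l l' ?_ hl hl'
  have h2 := Set.uIoc_subset_uIcc hξ
  rw [abs_le] at hp hq
  have h3 : Set.uIcc q p ⊆ Set.Icc (-M) M := Set.uIcc_subset_Icc hq hp
  exact abs_le.2 (h3 h2)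

lemma local1 {α M L K : ℝ} {x ℓ : ℝ → ℝ} (S : Setup α M L K x ℓ)
    (g : ℝ × ℝ → ℝ) (hg : ContDiff ℝ 2 g) :
    ∃ C : ℝ, 0 ≤ C ∧ (∀ s t, |Trap g x ℓ s t - (GG g (x t) (ℓ t) - GG g (x s) (ℓ t))|
        ≤ C * rho α |t - s|) ∧
      (∀ u s t, |(GG g (x s) (ℓ t) - GG g (x s) (ℓ s)) - (GG g (x u) (ℓ t) - GG g (x u) (ℓ s))|
        ≤ C * |t - s| * |s - u| ^ α) ∧
      (∀ s t, |GG g (x s) (ℓ t) - GG g (x s) (ℓ s)| ≤ C * |t - s|) := by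
  obtain ⟨B, hB0, hB⟩ := bounds g hg M
  have hα := S.hα
  have hL := S.hL
  have hK := S.hK
  have hM : 0 ≤ M := (abs_nonneg _).trans (S.bx 0)
  have hB1 : ∀ p l l' : ℝ, |p| ≤ M → |l| ≤ M → |l'| ≤ M →
      |g (p, l') - g (p, l)| ≤ B * |l' - l| :=
    fun p l l' hp hl hl' => (hB p p l l' hp hp hl hl').1
  have hmix := mixed g hg.continuous M B hB1
  refine ⟨max (max (2 * B * L ^ 3) (B * K * L)) (B * K * M), by positivity, ?_, ?_, ?_⟩
  · intro s t
    set d := |t - s| with hd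
    have hd0 : 0 ≤ d := abs_nonneg _
    have hcube : (d ^ α) ^ 3 = d ^ (3 * α) := by
      rw [← Real.rpow_natCast, ← Real.rpow_mul hd0, mul_comm]; norm_num
    have hone : d * d ^ α = d ^ (1 + α) := by
      rw [Real.rpow_add_of_nonneg hd0 (by norm_num) (by linarith), Real.rpow_one]
    have h1 := trapezoid (fun ξ => g (ξ, ℓ t)) (fun ξ => fderiv ℝ g (ξ, ℓ t) (1, 0))
      (fun ξ => by
        have h1 : HasFDerivAt g (fderiv ℝ g (ξ, ℓ t)) (ξ, ℓ t) :=
          (hg.differentiable (by norm_num) _).hasFDerivAt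
        exact h1.comp_hasDerivAt ξ ((hasDerivAt_id ξ).prodMk (hasDerivAt_const ξ (ℓ t))))
      B (x s) (x t) hB0
      (fun ξ hξ => by
        have h3 : Set.uIcc (x s) (x t) ⊆ Set.Icc (-M) M :=
          Set.uIcc_subset_Icc (abs_le.1 (S.bx s)) (abs_le.1 (S.bx t))
        exact (hB ξ (x s) (ℓ t) (ℓ t) (abs_le.2 (h3 hξ)) (S.bx s) (S.bl t) (S.bl t)).2)
    rw [← GG_sub g hg.continuous] at h1
    have h2 : |x t - x s| ^ 3 ≤ L ^ 3 * d ^ (3 * α) := by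
      rw [← hcube, ← mul_pow]
      exact pow_le_pow_left₀ (abs_nonneg _) (S.hx s t) 3
    have h3 : |(g (x s, ℓ s) - g (x s, ℓ t)) / 2 * (x t - x s)| ≤ B * K * L * d ^ (1 + α) := by
      rw [abs_mul, abs_div, abs_two]
      have e1 := hB1 (x s) (ℓ t) (ℓ s) (S.bx s) (S.bl t) (S.bl s)
      have e2 := S.hl s t
      rw [abs_sub_comm (ℓ s)] at e1
      have e3 : |g (x s, ℓ s) - g (x s, ℓ t)| / 2 ≤ B * K * d := by
        have : |g (x s, ℓ s) - g (x s, ℓ t)| ≤ B * (K * d) :=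
          e1.trans (mul_le_mul_of_nonneg_left e2 hB0)
        have := abs_nonneg (g (x s, ℓ s) - g (x s, ℓ t))
        linarith
      calc _ ≤ (B * K * d) * (L * d ^ α) := by
            apply mul_le_mul e3 (S.hx s t) (abs_nonneg _); positivity
        _ = _ := by rw [← hone]; ring
    have h4 : Trap g x ℓ s t - (GG g (x t) (ℓ t) - GG g (x s) (ℓ t))
        = (g (x s, ℓ s) - g (x s, ℓ t)) / 2 * (x t - x s)
          - ((GG g (x t) (ℓ t) - GG g (x s) (ℓ t)) -
            (g (x t, ℓ t) + g (x s, ℓ t)) / 2 * (x t - x s)) := by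
      unfold Trap; ring
    rw [h4]
    refine (abs_sub _ _).trans ?_
    unfold rho
    have h5 : 2 * B * |x t - x s| ^ 3 ≤ 2 * B * L ^ 3 * d ^ (3 * α) := by
      rw [mul_assoc _ (L^3)]; gcongr
    have p1 : 0 ≤ d ^ (3 * α) := by positivity
    have p2 : 0 ≤ d ^ (1 + α) := by positivity
    have m1 := mul_le_mul_of_nonneg_right
      ((le_max_left (2 * B * L ^ 3) (B * K * L)).trans (le_max_left _ (B * K * M))) p1
    have m2 := mul_le_mul_of_nonneg_right
      ((le_max_right (2 * B * L ^ 3) (B * K * L)).trans (le_max_left _ (B * K * M))) p2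
    rw [mul_add]
    linarith
  · intro u s t
    have h1 := hmix (x s) (x u) (ℓ s) (ℓ t) (S.bx s) (S.bx u) (S.bl s) (S.bl t)
    have hα0 : 0 ≤ |s - u| ^ α := by positivity
    calc _ ≤ _ := h1
      _ ≤ B * (K * |t - s|) * (L * |s - u| ^ α) := by
        apply mul_le_mul _ (S.hx u s) (abs_nonneg _) (by positivity)
        exact mul_le_mul_of_nonneg_left (S.hl s t) hB0
      _ = (B * K * L) * (|t - s| * |s - u| ^ α) := by ring
      _ ≤ _ := by
        rw [mul_assoc (max _ _)]
        apply mul_le_mul_of_nonneg_right _ (by positivity)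
        exact (le_max_right _ _).trans (le_max_left _ _)
  · intro s t
    have h1 := hmix (x s) 0 (ℓ s) (ℓ t) (S.bx s) (by simpa using hM) (S.bl s) (S.bl t)
    have h0 : ∀ l, GG g 0 l = 0 := fun l => by simp [GG]
    rw [h0, h0, sub_zero, sub_zero, sub_zero] at h1
    calc _ ≤ _ := h1
      _ ≤ B * (K * |t - s|) * M := by
        apply mul_le_mul _ (S.bx s) (abs_nonneg _) (by positivity)
        exact mul_le_mul_of_nonneg_left (S.hl s t) hB0
      _ = (B * K * M) * |t - s| := by ring
      _ ≤ _ := by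
        apply mul_le_mul_of_nonneg_right _ (by positivity)
        exact le_max_right _ _

lemma err_lim (α C : ℝ) (hα : 1/3 < α) (E : ℝ → ℝ → ℝ) (u v : ℝ)
    (hE : ∀ᶠ δ in 𝓝[>] (0:ℝ), ∀ s ∈ Set.uIoc u v, |E δ s| ≤ C * rho α δ) :
    Tendsto (fun δ : ℝ => δ⁻¹ * ∫ s in u..v, E δ s) (𝓝[>] 0) (𝓝 0) := by
  have h := (rho_lim α hα).const_mul (C * |v - u|)
  rw [mul_zero] at h
  refine squeeze_zero_norm' ?_ h
  filter_upwards [self_mem_nhdsWithin, hE] with δ (hδ : 0 < δ) hEδ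
  rw [norm_mul, Real.norm_of_nonneg (inv_nonneg.2 hδ.le)]
  have := intervalIntegral.norm_integral_le_of_norm_le_const (f := E δ) hEδ
  calc _ ≤ δ⁻¹ * (C * rho α δ * |v - u|) :=
        mul_le_mul_of_nonneg_left this (inv_nonneg.2 hδ.le)
    _ = _ := by ring

lemma exist {α M L K : ℝ} {x ℓ : ℝ → ℝ} (S : Setup α M L K x ℓ)
    (g : ℝ × ℝ → ℝ) (hg : ContDiff ℝ 2 g) (a b : ℝ) :
    ∃ I, Tendsto (fun δ : ℝ => δ⁻¹ * ∫ s in a..b, Trap g x ℓ s (s + δ)) (𝓝[>] 0) (𝓝 I) := by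
  obtain ⟨C, hC0, h1, -, h3⟩ := local1 S g hg
  have cx := S.contx
  have cl := S.lip.continuous
  have cg := hg.continuous
  have cG : ∀ u v : ℝ → ℝ, Continuous u → Continuous v → Continuous fun s => GG g (u s) (v s) :=
    fun u v hu hv => GG_cont g cg u v hu hv
  have t1 := err_lim α C S.hα (fun δ s => Trap g x ℓ s (s + δ)
    - (GG g (x (s + δ)) (ℓ (s + δ)) - GG g (x s) (ℓ (s + δ)))) a b (by
      filter_upwards [self_mem_nhdsWithin] with δ (hδ : 0 < δ) s _
      have := h1 s (s + δ)
      rwa [add_sub_cancel_left, abs_of_pos hδ] at this)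
  have t2 := avg (fun s => GG g (x s) (ℓ s)) (cG _ _ cx cl) a b
  have t3 : Tendsto (fun δ : ℝ => ∫ s in a..b, δ⁻¹ * (GG g (x s) (ℓ (s + δ)) - GG g (x s) (ℓ s)))
      (𝓝[>] 0) (𝓝 (∫ s in a..b, deriv (fun t => GG g (x s) (ℓ t)) s)) := by
    apply intervalIntegral.tendsto_integral_filter_of_dominated_convergence (fun _ => C)
    · refine Eventually.of_forall fun δ => Continuous.aestronglyMeasurable ?_
      exact continuous_const.mul ((cG _ _ cx (by fun_prop)).sub (cG _ _ cx cl))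
    · filter_upwards [self_mem_nhdsWithin] with δ (hδ : 0 < δ)
      refine Eventually.of_forall fun s _ => ?_
      have := h3 s (s + δ)
      rw [add_sub_cancel_left, abs_of_pos hδ] at this
      rw [norm_mul, Real.norm_of_nonneg (inv_nonneg.2 hδ.le), Real.norm_eq_abs,
        inv_mul_le_iff₀ hδ]
      linarith
    · exact intervalIntegrable_const
    · filter_upwards [S.lip.ae_differentiableAt_real] with s hs _
      have hd : DifferentiableAt ℝ (fun t => GG g (x s) (ℓ t)) s :=
        (GG_diff g hg (x s) (ℓ s)).comp s hs
      simpa using hd.hasDerivAt.tendsto_slope_zero_right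
  refine ⟨_, ((t1.add t2).sub t3).congr fun δ => ?_⟩
  rw [intervalIntegral.integral_const_mul, ← mul_add, ← mul_sub]
  have cT : Continuous fun s => Trap g x ℓ s (s + δ) := by unfold Trap; fun_prop
  have c1 := cG (fun s => x (s + δ)) (fun s => ℓ (s + δ)) (by fun_prop) (by fun_prop)
  have c2 := cG x (fun s => ℓ (s + δ)) (by fun_prop) (by fun_prop)
  have c3 := cG x ℓ (by fun_prop) (by fun_prop)
  rw [← intervalIntegral.integral_add, ← intervalIntegral.integral_sub]
  · congr 1
    apply intervalIntegral.integral_congr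
    intro s _
    simp only
    ring
  all_goals
    apply Continuous.intervalIntegrable
    fun_prop

lemma area {α M L K : ℝ} {x ℓ : ℝ → ℝ} (S : Setup α M L K x ℓ)
    (g : ℝ × ℝ → ℝ) (hg : ContDiff ℝ 2 g) :
    ∃ C, 0 ≤ C ∧ ∀ u v R, u ≤ v →
    Tendsto (fun δ : ℝ => δ⁻¹ * ∫ s in u..v, Trap g x ℓ s (s + δ)) (𝓝[>] 0) (𝓝 R) →
    |R - Trap g x ℓ u v| ≤ C * rho α (v - u) := by
  obtain ⟨C, hC0, h1, h2, -⟩ := local1 S g hg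
  have hα := S.hα
  have cx := S.contx
  have cl := S.lip.continuous
  have cg := hg.continuous
  have cG : ∀ u v : ℝ → ℝ, Continuous u → Continuous v → Continuous fun s => GG g (u s) (v s) :=
    fun u v hu hv => GG_cont g cg u v hu hv
  refine ⟨2 * C, by positivity, fun u v R huv hR => ?_⟩
  have hd0 : 0 ≤ v - u := sub_nonneg.2 huv
  have t2 := avg (fun s => GG g (x s) (ℓ s)) (cG _ _ cx cl) u v
  have t3 := avg (fun s => GG g (x u) (ℓ s)) (cG _ _ continuous_const cl) u v
  have t := ((hR.sub t2).add t3).norm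
  have tb := ((rho_lim α hα).const_mul (C * (v - u))).add_const (C * (v - u) ^ α * (v - u))
  rw [mul_zero, zero_add] at tb
  have hb := le_of_tendsto_of_tendsto t tb (by
    filter_upwards [self_mem_nhdsWithin] with δ (hδ : 0 < δ)
    have cT : Continuous fun s => Trap g x ℓ s (s + δ) := by unfold Trap; fun_prop
    have c1 := cG (fun s => x (s + δ)) (fun s => ℓ (s + δ)) (by fun_prop) (by fun_prop)
    have c2 := cG (fun _ => x u) (fun s => ℓ (s + δ)) (by fun_prop) (by fun_prop)
    have c3 := cG x ℓ (by fun_prop) (by fun_prop)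
    have c4 := cG (fun _ => x u) ℓ (by fun_prop) (by fun_prop)
    rw [← mul_sub, ← mul_add, ← intervalIntegral.integral_sub, ← intervalIntegral.integral_add]
    rotate_left
    iterate 4
      apply Continuous.intervalIntegrable
      fun_prop
    rw [norm_mul, Real.norm_of_nonneg (inv_nonneg.2 hδ.le)]
    have := intervalIntegral.norm_integral_le_of_norm_le_const (a := u) (b := v)
      (C := C * rho α δ + C * δ * (v - u) ^ α)
      (f := fun s => Trap g x ℓ s (s + δ) - (GG g (x (s + δ)) (ℓ (s + δ)) - GG g (x s) (ℓ s))
        + (GG g (x u) (ℓ (s + δ)) - GG g (x u) (ℓ s))) (by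
        intro s hs
        rw [Set.uIoc_of_le huv] at hs
        have e1 := h1 s (s + δ)
        have e2 := h2 u s (s + δ)
        rw [add_sub_cancel_left, abs_of_pos hδ] at e1 e2
        have e3 : |s - u| ^ α ≤ (v - u) ^ α := by
          apply Real.rpow_le_rpow (abs_nonneg _) _ (by linarith)
          rw [abs_of_pos (by linarith [hs.1])]
          linarith [hs.2]
        have e4 : C * δ * |s - u| ^ α ≤ C * δ * (v - u) ^ α := by gcongr
        rw [Real.norm_eq_abs]
        have e5 := (abs_sub _ _).trans (add_le_add e1 (e2.trans e4))
        refine le_trans (le_of_eq ?_) e5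
        congr 1
        ring)
    rw [abs_of_nonneg hd0] at this
    calc _ ≤ δ⁻¹ * ((C * rho α δ + C * δ * (v - u) ^ α) * (v - u)) :=
          mul_le_mul_of_nonneg_left this (inv_nonneg.2 hδ.le)
      _ = _ := by field_simp)
  have e1 := h1 u v
  rw [abs_of_nonneg hd0] at e1
  have hone : (v - u) ^ α * (v - u) = (v - u) ^ (1 + α) := by
    rw [Real.rpow_add_of_nonneg hd0 (by norm_num) (by linarith), Real.rpow_one, mul_comm]
  have e2 : C * (v - u) ^ α * (v - u) ≤ C * rho α (v - u) := by
    rw [mul_assoc, hone]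
    apply mul_le_mul_of_nonneg_left _ hC0
    unfold rho
    have : 0 ≤ (v - u) ^ (3 * α) := by positivity
    linarith
  rw [Real.norm_eq_abs] at hb
  have e3 := (abs_sub _ _).trans (add_le_add (hb.trans e2) e1)
  refine le_trans (le_of_eq ?_) (e3.trans (le_of_eq (by ring)))
  congr 1
  ring

lemma transfer (g : ℝ × ℝ → ℝ) (x ℓ x' ℓ' : ℝ → ℝ) (hx : ∀ t ∈ Set.Icc (0:ℝ) 3, x' t = x t)
    (hl : ∀ t ∈ Set.Icc (0:ℝ) 3, ℓ' t = ℓ t) (r s R : ℝ)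
    (hr : r ∈ Set.Icc (0:ℝ) 2) (hs : s ∈ Set.Icc (0:ℝ) 2) :
    RVTendsto (fun t => g (x t, ℓ t)) x r s R ↔
    Tendsto (fun δ : ℝ => δ⁻¹ * ∫ u in r..s, Trap g x' ℓ' u (u + δ)) (𝓝[>] 0) (𝓝 R) := by
  unfold RVTendsto
  apply tendsto_congr'
  filter_upwards [Ioo_mem_nhdsGT (show (0:ℝ) < 1 by norm_num)] with δ hδ
  congr 1
  apply intervalIntegral.integral_congr
  intro u hu
  have hu2 : u ∈ Set.Icc (0:ℝ) 2 := Set.uIcc_subset_Icc hr hs hu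
  have m1 : u ∈ Set.Icc (0:ℝ) 3 := ⟨hu2.1, by linarith [hu2.2]⟩
  have m2 : u + δ ∈ Set.Icc (0:ℝ) 3 := ⟨by linarith [hu2.1, hδ.1], by linarith [hu2.2, hδ.2]⟩
  simp only [Trap, hx _ m1, hx _ m2, hl _ m1, hl _ m2]

theorem stmt_11 (α : ℝ) (hα : α ∈ Set.Ioo (1/3 : ℝ) 1)
    (x : ℝ → ℝ) (hx : HolderOnIcc α 0 3 x)
    (h : ℝ × ℝ → ℝ) (hh : ContDiff ℝ 2 h)
    (ℓ : ℝ → ℝ) (hℓ : ∃ K : NNReal, LipschitzOnWith K ℓ (Set.Icc 0 3))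
    (y : ℝ → ℝ) (hy : ∀ t, y t = h (x t, ℓ t))
    (RV : ℝ → ℝ → ℝ)
    (hRV : ∀ r ∈ Set.Icc (0:ℝ) 2, ∀ s ∈ Set.Icc (0:ℝ) 2, RVTendsto y x r s (RV r s))
    (A : ℝ → ℝ → ℝ) (hA : ∀ r s, A r s = RV r s - (y r + y s) / 2 * (x s - x r)) :
    ∀ (f : ℝ → ℝ), ContDiff ℝ 2 f → ∀ a b : ℝ, 0 ≤ a → a ≤ b → b ≤ 1 →
      ∃ I : ℝ,
        Filter.Tendsto (fun ε => Ieps x y A f a b ε) (nhdsWithin 0 (Set.Ioi 0)) (nhds I) ∧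
        RVTendsto (fun s => f (y s)) x a b I := by
  intro f hf a b ha hab hb
  obtain ⟨L, hL0, hxL⟩ := hx
  obtain ⟨K, hK⟩ := hℓ
  have h03 : (0:ℝ) ≤ 3 := by norm_num
  have hα0 : 0 < α := by linarith [hα.1]
  set P : ℝ → ℝ := fun t => (Set.projIcc (0:ℝ) 3 h03 t : ℝ) with hP
  have Pmem : ∀ t, P t ∈ Set.Icc (0:ℝ) 3 := fun t => (Set.projIcc (0:ℝ) 3 h03 t).2
  have Peq : ∀ t ∈ Set.Icc (0:ℝ) 3, P t = t := fun t ht => by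
    simp [hP, Set.projIcc_of_mem h03 ht]
  have Plip : ∀ s t, |P t - P s| ≤ |t - s| := fun s t => Set.abs_projIcc_sub_projIcc h03
  have hℓK : ∀ s ∈ Set.Icc (0:ℝ) 3, ∀ t ∈ Set.Icc (0:ℝ) 3, |ℓ t - ℓ s| ≤ K * |t - s| := by
    intro s hs t ht
    have := hK.dist_le_mul t ht s hs
    simpa [Real.dist_eq] using this
  have Pb : ∀ s, |P s - 0| ≤ 3 := fun s => by
    rw [sub_zero, abs_of_nonneg (Pmem s).1]; exact (Pmem s).2
  have h0 : (0:ℝ) ∈ Set.Icc (0:ℝ) 3 := ⟨le_rfl, h03⟩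
  have hK0 : (0:ℝ) ≤ K := K.2
  have S : Setup α (|x 0| + |ℓ 0| + L * 3 ^ α + K * 3) L K (fun t => x (P t)) (fun t => ℓ (P t)) :=
    { hα := hα.1
      hL := hL0.le
      hK := hK0
      hx := fun s t => (hxL _ (Pmem s) _ (Pmem t)).trans (by
        have := Real.rpow_le_rpow (abs_nonneg _) (Plip s t) hα0.le
        exact mul_le_mul_of_nonneg_left this hL0.le)
      hl := fun s t => (hℓK _ (Pmem s) _ (Pmem t)).trans
        (mul_le_mul_of_nonneg_left (Plip s t) hK0)
      bx := fun s => by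
        have h1 := hxL 0 h0 _ (Pmem s)
        have h2 := mul_le_mul_of_nonneg_left
          (Real.rpow_le_rpow (abs_nonneg _) (Pb s) hα0.le) hL0.le
        have h3 := abs_sub_abs_le_abs_sub (x (P s)) (x 0)
        have h4 := abs_nonneg (ℓ 0)
        have h5 : (0:ℝ) ≤ K * 3 := by positivity
        linarith
      bl := fun s => by
        have h1 := hℓK 0 h0 _ (Pmem s)
        have h2 := mul_le_mul_of_nonneg_left (Pb s) hK0
        have h3 := abs_sub_abs_le_abs_sub (ℓ (P s)) (ℓ 0)
        have h4 := abs_nonneg (x 0)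
        have h5 : (0:ℝ) ≤ L * 3 ^ α := by positivity
        linarith }
  have hx' : ∀ t ∈ Set.Icc (0:ℝ) 3, (fun t => x (P t)) t = x t := fun t ht => by
    simp only [Peq t ht]
  have hl' : ∀ t ∈ Set.Icc (0:ℝ) 3, (fun t => ℓ (P t)) t = ℓ t := fun t ht => by
    simp only [Peq t ht]
  have hyf : y = fun t => h (x t, ℓ t) := funext hy
  have ma : a ∈ Set.Icc (0:ℝ) 2 := ⟨ha, by linarith⟩
  have mb : b ∈ Set.Icc (0:ℝ) 2 := ⟨by linarith, by linarith⟩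
  obtain ⟨I, hI⟩ := exist S (fun z => f (h z)) (hf.comp hh) a b
  rw [← transfer (fun z => f (h z)) x ℓ _ _ hx' hl' a b I ma mb] at hI
  have hRVf : RVTendsto (fun s => f (y s)) x a b I := by rw [hyf]; exact hI
  refine ⟨I, ?_, hRVf⟩
  obtain ⟨C, hC0, hC⟩ := area S h hh
  -- bound for the derivative factor
  have hdc : Continuous fun t => deriv f (h (x (P t), ℓ (P t))) := by
    have h1 := hf.continuous_deriv (by norm_num)
    have h2 := hh.continuous
    have h3 := S.contx
    have h4 := S.lip.continuous
    exact h1.comp (h2.comp (h3.prodMk h4))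
  obtain ⟨D, hD⟩ := (isCompact_Icc (a := (0:ℝ)) (b := 3)).exists_bound_of_continuousOn
    hdc.continuousOn
  have hz := err_lim α (D * C) hα.1 (fun ε u => deriv f (y u) * A u (u + ε)) a b (by
    filter_upwards [Ioo_mem_nhdsGT (show (0:ℝ) < 1 by norm_num)] with δ hδ u hu
    rw [Set.uIoc_of_le hab] at hu
    have m1 : u ∈ Set.Icc (0:ℝ) 2 := ⟨by linarith [hu.1], by linarith [hu.2]⟩
    have m2 : u + δ ∈ Set.Icc (0:ℝ) 2 :=
      ⟨by linarith [hu.1, hδ.1], by linarith [hu.2, hδ.2]⟩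
    have n1 : u ∈ Set.Icc (0:ℝ) 3 := ⟨m1.1, by linarith [m1.2]⟩
    have n2 : u + δ ∈ Set.Icc (0:ℝ) 3 := ⟨m2.1, by linarith [m2.2]⟩
    have r1 := hRV u m1 (u + δ) m2
    rw [hyf, transfer h x ℓ _ _ hx' hl' u (u + δ) _ m1 m2] at r1
    have r2 := hC u (u + δ) _ (by linarith [hδ.1]) r1
    have r3 : RV u (u + δ) - Trap h (fun t => x (P t)) (fun t => ℓ (P t)) u (u + δ)
        = A u (u + δ) := by
      rw [hA, hy, hy]
      simp only [Trap, Peq _ n1, Peq _ n2]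
      ring
    rw [r3, add_sub_cancel_left] at r2
    have d1 := hD u n1
    rw [Peq _ n1, ← hy, Real.norm_eq_abs] at d1
    rw [abs_mul, mul_assoc]
    exact mul_le_mul d1 r2 (abs_nonneg _) ((abs_nonneg _).trans d1))
  have hfin := hRVf.add hz
  rw [add_zero] at hfin
  refine hfin.congr fun ε => ?_
  unfold Ieps
  congr 2
  apply intervalIntegral.integral_congr
  intro u _
  simp only
  ring
end
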